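/- Let e₀₀⁰, e₀₀¹, e₀₂⁰, e₀₂¹, e₁₁⁰, e₁₁¹, e₁₃⁰, e₁₃¹ ∈ ℂ^d with p₀₀₀ = ‖e₀₀⁰‖², p₀₀₁ = ‖e₀₀¹‖², p₁₀₀ = ‖e₀₂⁰‖², p₁₀₁ = ‖e₀₂¹‖², p₀₁₀ = ‖e₁₁⁰‖², p₀₁₁ = ‖e₁₁¹‖², p₁₁₀ = ‖e₁₃⁰‖², p₁₁₁ = ‖e₁₃¹‖², summing to 2, and p₀₀₀ + p₁₁₁ > 0. Set f_0 = e₀₀⁰ + e₁₁⁰, f_1 = e₀₀¹ + e₁₁¹, f_2 = e₀₂⁰ + e₁₃⁰, f_3 = e₀₂¹ + e₁₃¹, assume ‖f_0‖² + ‖f_1‖² = 1 and ‖f_2‖² + ‖f_3‖² = 1, and set p₊₋ = ‖½(f_0 − f_1 + f_2 − f_3)‖², p₋₊ = ‖½(f_0 + f_1 − f_2 − f_3)‖². Define B = 1 − p₊₋ − p₋₊ − √(p₀₀₀p₁₀₁) − √(p₀₁₀p₁₀₁) − √(p₀₁₀p₁₁₁) − √(p₀₀₁p₁₀₀) − √(p₀₀₁p₁₁₀)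 − √(p₀₁₁p₁₀₀) − √(p₀₁₁p₁₁₀), and assume B ≥ 0. Let ρ_BEC and ρ_EC be the block-diagonal matrices with diagonal blocks, respectively, ½|e₀₀⁰⟩⟨e₀₀⁰|, ½|e₀₀¹⟩⟨e₀₀¹|, ½|e₀₂⁰⟩⟨e₀₂⁰|, ½|e₀₂¹⟩⟨e₀₂¹|, ½|e₁₁⁰⟩⟨e₁₁⁰|, ½|e₁₁¹⟩⟨e₁₁¹|, ½|e₁₃⁰⟩⟨e₁₃⁰|, ½|e₁₃¹⟩⟨e₁₃¹| (indexed by (Fin 8) × (Fin d)), and ½(|e₀₀⁰⟩⟨e₀₀⁰| + |e₁₃¹⟩⟨e₁₃¹|), ½(|e₀₂⁰⟩⟨e₀₂⁰| + |e₁₁¹⟩⟨e₁₁¹|), ½(|e₀₀¹⟩⟨e₀₀¹| + |e₁₃⁰⟩⟨e₁₃⁰|), ½(|e₀₂¹⟩⟨e₀₂¹| + |e₁₁⁰⟩⟨e₁₁⁰|) (indexed by (Fin 4) × (Fin d)). Then S(ρ_BEC) − S(ρ_EC) ≥ H(½p₀₀₀, ½p₀₀₁, ½p₁₀₀, ½p₁₀₁,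 ½p₀₁₀, ½p₀₁₁, ½p₁₁₀, ½p₁₁₁) − H(½(p₀₀₀+p₁₁₁), ½(p₁₀₀+p₀₁₁), ½(p₀₀₁+p₁₁₀), ½(p₁₀₁+p₀₁₀)) − ½(p₁₀₀ + p₀₁₁ + p₀₀₁ + p₁₁₀ + p₁₀₁ + p₀₁₀) − ½(p₀₀₀+p₁₁₁)·h(λ̃), where λ̃ = ½ + √( (p₀₀₀ − p₁₁₁)² + 4B² ) / (2(p₀₀₀ + p₁₁₁)), provided λ̃ ≤ 1. -/

import Mathlib

open scoped InnerProductSpace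

/-- Shannon entropy (base 2) of a finite tuple of reals. -/
noncomputable def shannonH {n : ℕ} (p : Fin n → ℝ) : ℝ := ∑ i, -(p i * Real.logb 2 (p i))

/-- The binary entropy function `h(p) = -p log₂ p - (1-p) log₂ (1-p)`. -/
noncomputable def binH (p : ℝ) : ℝ := -(p * Real.logb 2 p) - (1 - p) * Real.logb 2 (1 - p)

-- Von Neumann entropy (base 2) of a Hermitian complex matrix, via its eigenvalues
-- counted with multiplicity (and `0` for non-Hermitian matrices).
open scoped Classical in
noncomputable def vnEntropy {k : Type*} [Fintype k] [DecidableEq k] (ρ : Matrix k k ℂ) : ℝ :=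
  if h : ρ.IsHermitian then ∑ i, -(h.eigenvalues i * Real.logb 2 (h.eigenvalues i)) else 0

/-- The block-diagonal matrix indexed by `(Fin n) × (Fin m)` whose `j`-th diagonal block
is `σ j` and whose off-diagonal blocks are zero. -/
def blockDiag' {n m : ℕ} (σ : Fin n → Matrix (Fin m) (Fin m) ℂ) :
    Matrix (Fin n × Fin m) (Fin n × Fin m) ℂ :=
  Matrix.of fun p q => if p.1 = q.1 then σ p.1 p.2 q.2 else 0

/-- The outer product `|x⟩⟨x|` of a vector `x ∈ ℂ^d`: the `d×d` matrix with `(i,j)` entry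
`x i * conj (x j)`. -/
noncomputable def outer {d : ℕ} (x : EuclideanSpace ℂ (Fin d)) : Matrix (Fin d) (Fin d) ℂ :=
  Matrix.of fun i j => x i * (starRingEnd ℂ) (x j)

/-- The summand of the entropy. -/
noncomputable def gEnt (t : ℝ) : ℝ := -(t * Real.logb 2 t)

/-- Entropy of the roots of a polynomial. -/
noncomputable def entP (P : Polynomial ℂ) : ℝ := (P.roots.map (fun z => gEnt z.re)).sum

lemma entP_mul {P Q : Polynomial ℂ} (h : P * Q ≠ 0) : entP (P * Q) = entP P + entP Q := by
  simp [entP, Polynomial.roots_mul h]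

lemma entP_X_pow (n : ℕ) : entP (Polynomial.X ^ n) = 0 := by
  simp [entP, gEnt, Multiset.map_nsmul, Multiset.sum_nsmul]

lemma entP_prod {ι : Type*} (s : Finset ι) (P : ι → Polynomial ℂ) (h : ∀ i ∈ s, (P i).Monic) :
    entP (∏ i ∈ s, P i) = ∑ i ∈ s, entP (P i) := by
  classical
  induction s using Finset.induction_on with
  | empty => simp [entP]
  | insert a s ha ih =>
    rw [Finset.prod_insert ha, Finset.sum_insert ha, entP_mul, ih]
    · intro i hi
      exact h i (Finset.mem_insert_of_mem hi)
    · exact ((h a (Finset.mem_insert_self a s)).mul (Polynomial.monic_prod_of_monic _ _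
        (fun i hi => h i (Finset.mem_insert_of_mem hi)))).ne_zero

lemma entP_mul_comm {m n : Type*} [Fintype m] [Fintype n] [DecidableEq m] [DecidableEq n]
    (A : Matrix m n ℂ) (B : Matrix n m ℂ) : entP (A * B).charpoly = entP (B * A).charpoly := by
  have h := congrArg entP (Matrix.charpoly_mul_comm' A B)
  rw [entP_mul, entP_mul, entP_X_pow, entP_X_pow] at h
  · simpa using h
  · exact ((Polynomial.monic_X_pow _).mul (Matrix.charpoly_monic _)).ne_zero
  · exact ((Polynomial.monic_X_pow _).mul (Matrix.charpoly_monic _)).ne_zero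

lemma vnEntropy_eq {k : Type*} [Fintype k] [DecidableEq k] (ρ : Matrix k k ℂ)
    (h : ρ.IsHermitian) : vnEntropy ρ = entP ρ.charpoly := by
  rw [vnEntropy, dif_pos h, entP, h.roots_charpoly_eq_eigenvalues, Multiset.map_map]
  simp [gEnt]

lemma charpoly_blockDiag' {n m : ℕ} (σ : Fin n → Matrix (Fin m) (Fin m) ℂ) :
    (blockDiag' σ).charpoly = ∏ i, (σ i).charpoly := by
  have h1 : blockDiag' σ = Matrix.reindex (Equiv.prodComm _ _) (Equiv.prodComm _ _)
      (Matrix.blockDiagonal σ) := by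
    ext p q
    simp [blockDiag', Matrix.blockDiagonal_apply]
  rw [h1, Matrix.charpoly_reindex, Matrix.charpoly]
  have h2 : (Matrix.blockDiagonal σ).charmatrix
      = Matrix.blockDiagonal (fun i => (σ i).charmatrix) := by
    ext1 p q
    obtain ⟨p1, p2⟩ := p
    obtain ⟨q1, q2⟩ := q
    simp only [Matrix.charmatrix_apply, Matrix.blockDiagonal_apply, Matrix.diagonal_apply,
      Prod.mk.injEq]
    by_cases h : p2 = q2
    · subst h; simp
    · simp [h]
  rw [h2, Matrix.det_blockDiagonal]
  rfl

lemma blockDiag'_isHermitian {n m : ℕ} (σ : Fin n → Matrix (Fin m) (Fin m) ℂ)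
    (h : ∀ i, (σ i).IsHermitian) : (blockDiag' σ).IsHermitian := by
  ext p q
  obtain ⟨p1, p2⟩ := p
  obtain ⟨q1, q2⟩ := q
  simp only [blockDiag', Matrix.conjTranspose_apply, Matrix.of_apply]
  by_cases hh : p1 = q1
  · subst hh
    simpa using (h p1).apply p2 q2
  · simp [hh, Ne.symm hh]

lemma vnEntropy_blockDiag' {n m : ℕ} (σ : Fin n → Matrix (Fin m) (Fin m) ℂ)
    (h : ∀ i, (σ i).IsHermitian) : vnEntropy (blockDiag' σ) = ∑ i, entP (σ i).charpoly := by
  rw [vnEntropy_eq _ (blockDiag'_isHermitian σ h), charpoly_blockDiag', entP_prod]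
  intro i _
  exact Matrix.charpoly_monic _

lemma outer_isHermitian {d : ℕ} (x : EuclideanSpace ℂ (Fin d)) : (outer x).IsHermitian := by
  ext i j
  simp [outer, mul_comm]

lemma half_isHermitian {d : ℕ} {M : Matrix (Fin d) (Fin d) ℂ} (h : M.IsHermitian) :
    ((1 / 2 : ℂ) • M).IsHermitian := by
  ext i j
  have := h.apply i j
  simp only [Matrix.conjTranspose_apply, Matrix.smul_apply, smul_eq_mul, star_mul']
  rw [this]
  simp

lemma entP_quad (a b : ℝ) :
    entP ((Polynomial.X - Polynomial.C (a : ℂ)) * (Polynomial.X - Polynomial.C (b : ℂ)))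
      = gEnt a + gEnt b := by
  rw [entP_mul ((Polynomial.monic_X_sub_C _).mul (Polynomial.monic_X_sub_C _)).ne_zero]
  simp [entP]

lemma norm_sq_sum {d : ℕ} (x : EuclideanSpace ℂ (Fin d)) :
    ∑ i, (starRingEnd ℂ) (x i) * x i = ((‖x‖ ^ 2 : ℝ) : ℂ) := by
  have := inner_self_eq_norm_sq_to_K (𝕜 := ℂ) x
  rw [PiLp.inner_apply] at this
  simp only [RCLike.inner_apply] at this
  push_cast
  simpa [mul_comm] using this

lemma entP_pair {d : ℕ} (x y : EuclideanSpace ℂ (Fin d)) :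
    entP ((1 / 2 : ℂ) • (outer x + outer y)).charpoly =
      gEnt ((‖x‖ ^ 2 + ‖y‖ ^ 2
        + Real.sqrt ((‖x‖ ^ 2 - ‖y‖ ^ 2) ^ 2 + 4 * ‖(inner ℂ x y : ℂ)‖ ^ 2)) / 4) +
      gEnt ((‖x‖ ^ 2 + ‖y‖ ^ 2
        - Real.sqrt ((‖x‖ ^ 2 - ‖y‖ ^ 2) ^ 2 + 4 * ‖(inner ℂ x y : ℂ)‖ ^ 2)) / 4) := by
  set D := Real.sqrt ((‖x‖ ^ 2 - ‖y‖ ^ 2) ^ 2 + 4 * ‖(inner ℂ x y : ℂ)‖ ^ 2) with hD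
  have hD2 : D ^ 2 = (‖x‖ ^ 2 - ‖y‖ ^ 2) ^ 2 + 4 * ‖(inner ℂ x y : ℂ)‖ ^ 2 :=
    Real.sq_sqrt (by positivity)
  let V : Matrix (Fin d) (Fin 2) ℂ := Matrix.of fun i j => ![x i, y i] j
  let W : Matrix (Fin 2) (Fin d) ℂ :=
    Matrix.of fun j i => (1 / 2 : ℂ) * (starRingEnd ℂ) (![x i, y i] j)
  have h1 : (1 / 2 : ℂ) • (outer x + outer y) = V * W := by
    ext i j
    simp [V, W, outer, Matrix.mul_apply, Fin.sum_univ_two]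
    ring
  have hxy : ∑ i, (starRingEnd ℂ) (x i) * y i = inner ℂ x y := by
    rw [PiLp.inner_apply]
    simp [mul_comm]
  have hyx : ∑ i, (starRingEnd ℂ) (y i) * x i = (starRingEnd ℂ) (inner ℂ x y) := by
    rw [← hxy]
    simp [mul_comm]
  have h2 : W * V = !![(1 / 2 : ℂ) * ((‖x‖ ^ 2 : ℝ) : ℂ), (1 / 2 : ℂ) * inner ℂ x y;
      (1 / 2 : ℂ) * (starRingEnd ℂ) (inner ℂ x y), (1 / 2 : ℂ) * ((‖y‖ ^ 2 : ℝ) : ℂ)] := by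
    rw [← norm_sq_sum x, ← norm_sq_sum y, ← hyx, ← hxy]
    ext i j
    fin_cases i <;> fin_cases j <;>
      simp [V, W, Matrix.mul_apply, Finset.mul_sum, mul_assoc]
  have hc : (inner ℂ x y : ℂ) * (starRingEnd ℂ) (inner ℂ x y)
      = ((‖(inner ℂ x y : ℂ)‖ ^ 2 : ℝ) : ℂ) := by
    rw [Complex.mul_conj, Complex.normSq_eq_norm_sq]
  have hDc : ((D ^ 2 : ℝ) : ℂ) = (((‖x‖ ^ 2 - ‖y‖ ^ 2) ^ 2 : ℝ) : ℂ)
      + 4 * ((‖(inner ℂ x y : ℂ)‖ ^ 2 : ℝ) : ℂ) := by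
    rw [hD2]; push_cast; ring
  rw [h1, entP_mul_comm, h2, Matrix.charpoly_fin_two, ← entP_quad]
  congr 1
  rw [Matrix.trace_fin_two, Matrix.det_fin_two]
  simp only [Matrix.of_apply, Matrix.cons_val', Matrix.cons_val_zero, Matrix.cons_val_one,
    Matrix.cons_val_fin_one]
  set a : ℝ := ‖x‖ ^ 2
  set b : ℝ := ‖y‖ ^ 2
  have e1 : (1 / 2 : ℂ) * (a : ℂ) + (1 / 2 : ℂ) * (b : ℂ)
      = (((a + b + D) / 4 : ℝ) : ℂ) + (((a + b - D) / 4 : ℝ) : ℂ) := by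
    push_cast; ring
  have e2 : (1 / 2 : ℂ) * (a : ℂ) * ((1 / 2 : ℂ) * (b : ℂ)) -
      (1 / 2 : ℂ) * inner ℂ x y * ((1 / 2 : ℂ) * (starRingEnd ℂ) (inner ℂ x y))
      = (((a + b + D) / 4 : ℝ) : ℂ) * (((a + b - D) / 4 : ℝ) : ℂ) := by
    have : (1 / 2 : ℂ) * inner ℂ x y * ((1 / 2 : ℂ) * (starRingEnd ℂ) (inner ℂ x y))
      = 1 / 4 * ((inner ℂ x y : ℂ) * (starRingEnd ℂ) (inner ℂ x y)) := by ring
    rw [this, hc]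
    push_cast at hDc ⊢
    linear_combination (1 / 16 : ℂ) * hDc
  rw [e1, e2, Polynomial.C_add, Polynomial.C_mul]
  ring

lemma entP_single {d : ℕ} (x : EuclideanSpace ℂ (Fin d)) :
    entP ((1 / 2 : ℂ) • outer x).charpoly = gEnt (‖x‖ ^ 2 / 2) := by
  have h0 : outer (0 : EuclideanSpace ℂ (Fin d)) = 0 := by
    ext i j; simp [outer]
  have := entP_pair x 0
  rw [h0, add_zero] at this
  rw [this]
  have hs : Real.sqrt ((‖x‖ ^ 2) ^ 2) = ‖x‖ ^ 2 := Real.sqrt_sq (by positivity)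
  simp only [norm_zero, inner_zero_right, ne_eq, OfNat.ofNat_ne_zero, not_false_eq_true, zero_pow,
    mul_zero, add_zero, sub_zero, hs, sub_self, zero_div]
  have : gEnt 0 = 0 := by simp [gEnt]
  rw [this, add_zero]
  congr 1
  ring

lemma binH_eq (p : ℝ) : binH p = Real.binEntropy p / Real.log 2 := by
  rw [binH, Real.binEntropy, Real.logb, Real.logb, Real.log_inv, Real.log_inv]
  ring

lemma gEnt_mul (s t : ℝ) (hs : 0 < s) : gEnt (s * t) = t * gEnt s + s * gEnt t := by
  by_cases ht : t = 0
  · subst ht; simp [gEnt]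
  · rw [gEnt, Real.logb_mul hs.ne' ht, gEnt, gEnt]
    ring

/-- The grouping rule for the two eigenvalues. -/
lemma gEnt_split (s D : ℝ) (hs : 0 < s) :
    gEnt ((s + D) / 4) + gEnt ((s - D) / 4)
      = gEnt (s / 2) + s / 2 * binH (1 / 2 + D / (2 * s)) := by
  have e1 : (s + D) / 4 = s / 2 * (1 / 2 + D / (2 * s)) := by field_simp; ring
  have e2 : (s - D) / 4 = s / 2 * (1 - (1 / 2 + D / (2 * s))) := by field_simp; ring
  rw [e1, e2, gEnt_mul _ _ (by positivity), gEnt_mul _ _ (by positivity), binH]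
  simp only [gEnt]
  ring

lemma disc_le {d : ℕ} (x y : EuclideanSpace ℂ (Fin d)) :
    Real.sqrt ((‖x‖ ^ 2 - ‖y‖ ^ 2) ^ 2 + 4 * ‖(inner ℂ x y : ℂ)‖ ^ 2) ≤ ‖x‖ ^ 2 + ‖y‖ ^ 2 := by
  apply Real.sqrt_le_iff.mpr ⟨by positivity, ?_⟩
  have h := norm_inner_le_norm (𝕜 := ℂ) x y
  have h2 : ‖(inner ℂ x y : ℂ)‖ ^ 2 ≤ (‖x‖ * ‖y‖) ^ 2 := by gcongr
  nlinarith

lemma entP_pair_le {d : ℕ} (x y : EuclideanSpace ℂ (Fin d)) (a b : ℝ) (ha : a = ‖x‖ ^ 2)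
    (hb : b = ‖y‖ ^ 2) :
    entP ((1 / 2 : ℂ) • (outer x + outer y)).charpoly ≤ gEnt ((a + b) / 2) + 1 / 2 * (a + b) := by
  rw [entP_pair, ← ha, ← hb]
  have hd := disc_le x y
  rw [← ha, ← hb] at hd
  have hs0 : 0 ≤ a + b := by rw [ha, hb]; positivity
  rcases hs0.eq_or_lt with hs | hs
  · have hD : Real.sqrt ((a - b) ^ 2 + 4 * ‖(inner ℂ x y : ℂ)‖ ^ 2) = 0 :=
      le_antisymm (hs ▸ hd) (Real.sqrt_nonneg _)
    rw [hD, ← hs]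
    simp [gEnt]
  · rw [gEnt_split _ _ hs]
    have : binH (1 / 2 + Real.sqrt ((a - b) ^ 2 + 4 * ‖(inner ℂ x y : ℂ)‖ ^ 2) / (2 * (a + b)))
        ≤ 1 := by
      rw [binH_eq, div_le_one (Real.log_pos (by norm_num))]
      exact Real.binEntropy_le_log_two
    nlinarith

lemma entP_pair_le' {d : ℕ} (x y : EuclideanSpace ℂ (Fin d)) (a b B : ℝ) (ha : a = ‖x‖ ^ 2)
    (hb : b = ‖y‖ ^ 2) (hs : 0 < a + b) (hB : 0 ≤ B) (hBi : B ≤ (inner ℂ x y : ℂ).re) :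
    entP ((1 / 2 : ℂ) • (outer x + outer y)).charpoly ≤ gEnt ((a + b) / 2)
      + 1 / 2 * (a + b) * binH (1 / 2 + Real.sqrt ((a - b) ^ 2 + 4 * B ^ 2) / (2 * (a + b))) := by
  rw [entP_pair, ← ha, ← hb]
  have hd := disc_le x y
  rw [← ha, ← hb] at hd
  rw [gEnt_split _ _ hs]
  have hBn : B ≤ ‖(inner ℂ x y : ℂ)‖ := hBi.trans (Complex.re_le_norm _)
  have hle : Real.sqrt ((a - b) ^ 2 + 4 * B ^ 2)
      ≤ Real.sqrt ((a - b) ^ 2 + 4 * ‖(inner ℂ x y : ℂ)‖ ^ 2) := by gcongr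
  have hn := Real.sqrt_nonneg ((a - b) ^ 2 + 4 * B ^ 2)
  set D := Real.sqrt ((a - b) ^ 2 + 4 * ‖(inner ℂ x y : ℂ)‖ ^ 2)
  set E := Real.sqrt ((a - b) ^ 2 + 4 * B ^ 2)
  have h1 : E / (2 * (a + b)) ≤ D / (2 * (a + b)) := by gcongr
  have h2 : D / (2 * (a + b)) ≤ 1 / 2 := by
    rw [div_le_iff₀ (by positivity)]; linarith
  have h0 : 0 ≤ E / (2 * (a + b)) := by positivity
  have hh : binH (1 / 2 + D / (2 * (a + b))) ≤ binH (1 / 2 + E / (2 * (a + b))) := by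
    rw [binH_eq, binH_eq]
    apply div_le_div_of_nonneg_right _ (Real.log_pos (by norm_num)).le
    apply Real.binEntropy_strictAntiOn.antitoneOn
    · constructor <;> norm_num <;> linarith
    · constructor <;> norm_num <;> linarith
    · linarith
  nlinarith

lemma re_inner_le_sqrt {d : ℕ} (x y : EuclideanSpace ℂ (Fin d)) (a b : ℝ) (ha : a = ‖x‖ ^ 2)
    (hb : b = ‖y‖ ^ 2) : (inner ℂ x y : ℂ).re ≤ Real.sqrt (a * b) := by
  rw [ha, hb, ← mul_pow, Real.sqrt_sq (by positivity)]
  exact (Complex.re_le_norm _).trans (norm_inner_le_norm x y)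

/-- The parallelogram identity behind the bound `B`. -/
lemma pm_identity {d : ℕ} (f₀ f₁ f₂ f₃ : EuclideanSpace ℂ (Fin d))
    (h01 : ‖f₀‖ ^ 2 + ‖f₁‖ ^ 2 = 1) (h23 : ‖f₂‖ ^ 2 + ‖f₃‖ ^ 2 = 1) :
    1 - ‖(1 / 2 : ℂ) • (f₀ - f₁ + f₂ - f₃)‖ ^ 2 - ‖(1 / 2 : ℂ) • (f₀ + f₁ - f₂ - f₃)‖ ^ 2
      = (inner ℂ f₀ f₃ : ℂ).re + (inner ℂ f₁ f₂ : ℂ).re := by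
  have e1 : f₀ - f₁ + f₂ - f₃ = (f₀ - f₃) - (f₁ - f₂) := by abel
  have e2 : f₀ + f₁ - f₂ - f₃ = (f₀ - f₃) + (f₁ - f₂) := by abel
  have hp := parallelogram_law_with_norm ℂ (f₀ - f₃) (f₁ - f₂)
  have hA := norm_sub_sq (𝕜 := ℂ) f₀ f₃
  have hC := norm_sub_sq (𝕜 := ℂ) f₁ f₂
  simp only [RCLike.re_to_complex] at hA hC
  rw [e1, e2, norm_smul, norm_smul]
  have : ‖(1 / 2 : ℂ)‖ = 1 / 2 := by simp
  rw [this]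
  linarith

theorem stmt16 (d : ℕ) (e000 e001 e020 e021 e110 e111 e130 e131 : EuclideanSpace ℂ (Fin d))
    (p000 p001 p100 p101 p010 p011 p110 p111 : ℝ)
    (hp000 : p000 = ‖e000‖ ^ 2) (hp001 : p001 = ‖e001‖ ^ 2)
    (hp100 : p100 = ‖e020‖ ^ 2) (hp101 : p101 = ‖e021‖ ^ 2)
    (hp010 : p010 = ‖e110‖ ^ 2) (hp011 : p011 = ‖e111‖ ^ 2)
    (hp110 : p110 = ‖e130‖ ^ 2) (hp111 : p111 = ‖e131‖ ^ 2)
    (hsum : p000 + p001 + p100 + p101 + p010 + p011 + p110 + p111 = 2)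
    (hpos : 0 < p000 + p111)
    (f₀ f₁ f₂ f₃ : EuclideanSpace ℂ (Fin d))
    (hf₀ : f₀ = e000 + e110) (hf₁ : f₁ = e001 + e111)
    (hf₂ : f₂ = e020 + e130) (hf₃ : f₃ = e021 + e131)
    (h01 : ‖f₀‖ ^ 2 + ‖f₁‖ ^ 2 = 1) (h23 : ‖f₂‖ ^ 2 + ‖f₃‖ ^ 2 = 1)
    (pPM pMP : ℝ)
    (hpPM : pPM = ‖(1 / 2 : ℂ) • (f₀ - f₁ + f₂ - f₃)‖ ^ 2)
    (hpMP : pMP = ‖(1 / 2 : ℂ) • (f₀ + f₁ - f₂ - f₃)‖ ^ 2)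
    (B : ℝ)
    (hB : B = 1 - pPM - pMP - Real.sqrt (p000 * p101) - Real.sqrt (p010 * p101)
      - Real.sqrt (p010 * p111) - Real.sqrt (p001 * p100) - Real.sqrt (p001 * p110)
      - Real.sqrt (p011 * p100) - Real.sqrt (p011 * p110))
    (hBnonneg : 0 ≤ B)
    (ρBEC : Matrix (Fin 8 × Fin d) (Fin 8 × Fin d) ℂ)
    (hρBEC : ρBEC = blockDiag'
      ![(1 / 2 : ℂ) • outer e000, (1 / 2 : ℂ) • outer e001,
        (1 / 2 : ℂ) • outer e020, (1 / 2 : ℂ) • outer e021,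
        (1 / 2 : ℂ) • outer e110, (1 / 2 : ℂ) • outer e111,
        (1 / 2 : ℂ) • outer e130, (1 / 2 : ℂ) • outer e131])
    (ρEC : Matrix (Fin 4 × Fin d) (Fin 4 × Fin d) ℂ)
    (hρEC : ρEC = blockDiag'
      ![(1 / 2 : ℂ) • (outer e000 + outer e131),
        (1 / 2 : ℂ) • (outer e020 + outer e111),
        (1 / 2 : ℂ) • (outer e001 + outer e130),
        (1 / 2 : ℂ) • (outer e021 + outer e110)])
    (lam : ℝ)
    (hlam : lam = 1 / 2 +
      Real.sqrt ((p000 - p111) ^ 2 + 4 * B ^ 2) / (2 * (p000 + p111)))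
    (hlam1 : lam ≤ 1) :
    vnEntropy ρBEC - vnEntropy ρEC ≥
      shannonH ![p000 / 2, p001 / 2, p100 / 2, p101 / 2, p010 / 2, p011 / 2, p110 / 2, p111 / 2]
        - shannonH ![(p000 + p111) / 2, (p100 + p011) / 2, (p001 + p110) / 2, (p101 + p010) / 2]
        - 1 / 2 * (p100 + p011 + p001 + p110 + p101 + p010)
        - 1 / 2 * (p000 + p111) * binH lam := by
  have hid := pm_identity f₀ f₁ f₂ f₃ h01 h23
  rw [← hpPM, ← hpMP, hf₀, hf₁, hf₂, hf₃] at hid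
  simp only [inner_add_left, inner_add_right, Complex.add_re] at hid
  have i1 := re_inner_le_sqrt e000 e021 _ _ hp000 hp101
  have i2 := re_inner_le_sqrt e110 e021 _ _ hp010 hp101
  have i3 := re_inner_le_sqrt e110 e131 _ _ hp010 hp111
  have i4 := re_inner_le_sqrt e001 e020 _ _ hp001 hp100
  have i5 := re_inner_le_sqrt e001 e130 _ _ hp001 hp110
  have i6 := re_inner_le_sqrt e111 e020 _ _ hp011 hp100
  have i7 := re_inner_le_sqrt e111 e130 _ _ hp011 hp110
  have hBi : B ≤ (inner ℂ e000 e131 : ℂ).re := by linarith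
  have b0 := entP_pair_le' e000 e131 _ _ B hp000 hp111 hpos hBnonneg hBi
  rw [← hlam] at b0
  have b1 := entP_pair_le e020 e111 _ _ hp100 hp011
  have b2 := entP_pair_le e001 e130 _ _ hp001 hp110
  have b3 := entP_pair_le e021 e110 _ _ hp101 hp010
  have S1 : vnEntropy ρBEC = shannonH ![p000 / 2, p001 / 2, p100 / 2, p101 / 2, p010 / 2,
      p011 / 2, p110 / 2, p111 / 2] := by
    rw [hρBEC, vnEntropy_blockDiag']
    · simp only [shannonH, Fin.sum_univ_eight, Matrix.cons_val]
      simp only [entP_single, gEnt, ← hp000, ← hp001, ← hp100, ← hp101, ← hp010, ← hp011,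
        ← hp110, ← hp111]
    · intro i
      fin_cases i <;> exact half_isHermitian (outer_isHermitian _)
  have S2 : vnEntropy ρEC = entP ((1 / 2 : ℂ) • (outer e000 + outer e131)).charpoly
      + entP ((1 / 2 : ℂ) • (outer e020 + outer e111)).charpoly
      + entP ((1 / 2 : ℂ) • (outer e001 + outer e130)).charpoly
      + entP ((1 / 2 : ℂ) • (outer e021 + outer e110)).charpoly := by
    rw [hρEC, vnEntropy_blockDiag']
    · simp only [Fin.sum_univ_four, Matrix.cons_val]
    · intro i
      fin_cases i <;>
        exact half_isHermitian ((outer_isHermitian _).add (outer_isHermitian _))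
  have S3 : shannonH ![(p000 + p111) / 2, (p100 + p011) / 2, (p001 + p110) / 2,
      (p101 + p010) / 2] = gEnt ((p000 + p111) / 2) + gEnt ((p100 + p011) / 2)
        + gEnt ((p001 + p110) / 2) + gEnt ((p101 + p010) / 2) := by
    simp only [shannonH, Fin.sum_univ_four, Matrix.cons_val, gEnt]
  rw [S1, S2, S3]
  linarith
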